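/- arXiv:2504.15985 — 2 statements merged into one kernel-verified Lean document; each statement's English description precedes it below -/
import Mathlib

section
/- Let (Y, Z) be jointly Gaussian with Y real-valued, Z ℝ²-valued, means zero, Var(Y) = σ₁²(t+h)^{2H₁}, Cov(Y, Z) = (σ₁² w(t,h,H₁), ρσ₁σ₂ w(t,h,H)) and Cov(Z) the 2×2 matrix with entries σ₁²t^{2H₁}, ρσ₁σ₂ t^{2H} (off-diagonal), σ₂² t^{2H₂}, where H = (H₁+H₂)/2, w(t,h,H) = (1/2)((t+h)^{2H} + t^{2H} - h^{2H}), |ρ| < 1, t, h > 0. Then E[Y | Z = (z₁,z₂)] = w¹¹ z₁ + w¹² z₂ with w¹¹ = (1/(1-ρ²))(w(t,h,H₁)/t^{2H₁} - ρ² w(t,h,H)/t^{2H}) and w¹² = (ρ/(1-ρ²))(σ₁/σ₂)(w(t,h,H)/t^{2H₂} - w(t,h,H₁)/t^{2H}). -/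
open MeasureTheory ProbabilityTheory Real

/-- If the residual `Y - α Z₁ - β Z₂` is uncorrelated with `Z₁, Z₂` then the conditional expectation
of `Y` is the linear combination. -/
lemma condExp_of_normal_equations
    {Ω : Type*} [MeasurableSpace Ω] (μ : Measure Ω) [IsProbabilityMeasure μ]
    (Y Z₁ Z₂ : Ω → ℝ) (hY : Measurable Y) (hZ₁ : Measurable Z₁) (hZ₂ : Measurable Z₂)
    (hGauss : ∀ a b c : ℝ, ∃ v : NNReal,
      Measure.map (fun ω => a * Y ω + b * Z₁ ω + c * Z₂ ω) μ = gaussianReal 0 v)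
    (α β : ℝ)
    (h1 : ∫ ω, Y ω * Z₁ ω ∂μ = α * ∫ ω, (Z₁ ω) ^ 2 ∂μ + β * ∫ ω, Z₁ ω * Z₂ ω ∂μ)
    (h2 : ∫ ω, Y ω * Z₂ ω ∂μ = α * ∫ ω, Z₁ ω * Z₂ ω ∂μ + β * ∫ ω, (Z₂ ω) ^ 2 ∂μ) :
    μ[Y | MeasurableSpace.comap (fun ω => (Z₁ ω, Z₂ ω)) inferInstance]
      =ᵐ[μ] fun ω => α * Z₁ ω + β * Z₂ ω := by
  have key : ∀ a b c : ℝ, MemLp (fun ω => a * Y ω + b * Z₁ ω + c * Z₂ ω) 2 μ ∧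
      ∫ ω, (a * Y ω + b * Z₁ ω + c * Z₂ ω) ∂μ = 0 := by
    intro a b c
    obtain ⟨v, hv⟩ := hGauss a b c
    have hm : AEMeasurable (fun ω => a * Y ω + b * Z₁ ω + c * Z₂ ω) μ := by fun_prop
    constructor
    · have h := memLp_id_gaussianReal (μ := 0) (v := v) 2
      rw [← hv] at h
      exact (memLp_map_measure_iff (by fun_prop) hm).1 h
    · have h := integral_id_gaussianReal (μ := 0) (v := v)
      rw [← hv, integral_map hm (by fun_prop)] at h
      exact h
  have mY : MemLp Y 2 μ := by simpa using (key 1 0 0).1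
  have mZ₁ : MemLp Z₁ 2 μ := by simpa using (key 0 1 0).1
  have mZ₂ : MemLp Z₂ 2 μ := by simpa using (key 0 0 1).1
  have eZ₁ : ∫ ω, Z₁ ω ∂μ = 0 := by simpa using (key 0 1 0).2
  have eZ₂ : ∫ ω, Z₂ ω ∂μ = 0 := by simpa using (key 0 0 1).2
  set R : Ω → ℝ := fun ω => Y ω - α * Z₁ ω - β * Z₂ ω with hR
  have hRm : Measurable R := by fun_prop
  have mR : MemLp R 2 μ := (mY.sub (mZ₁.const_mul α)).sub (mZ₂.const_mul β)
  have eR : ∫ ω, R ω ∂μ = 0 := by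
    have := (key 1 (-α) (-β)).2
    rw [← this]
    congr 1; ext ω; simp only [hR]; ring
  have i1 : Integrable (fun ω => Y ω * Z₁ ω) μ := mY.integrable_mul mZ₁
  have i2 : Integrable (fun ω => Y ω * Z₂ ω) μ := mY.integrable_mul mZ₂
  have i3 : Integrable (fun ω => Z₁ ω * Z₂ ω) μ := mZ₁.integrable_mul mZ₂
  have i4 : Integrable (fun ω => Z₁ ω ^ 2) μ := mZ₁.integrable_sq
  have i5 : Integrable (fun ω => Z₂ ω ^ 2) μ := mZ₂.integrable_sq
  have c1 : cov[R, Z₁; μ] = 0 := by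
    rw [covariance_eq_sub mR mZ₁, eZ₁, mul_zero, sub_zero]
    have : R * Z₁ = fun ω => Y ω * Z₁ ω - α * Z₁ ω ^ 2 - β * (Z₁ ω * Z₂ ω) := by
      ext ω; simp only [hR, Pi.mul_apply]; ring
    have i6 : Integrable (fun ω => Y ω * Z₁ ω - α * Z₁ ω ^ 2) μ := i1.sub (i4.const_mul α)
    rw [this, integral_sub i6 (i3.const_mul β),
      integral_sub i1 (i4.const_mul α), integral_const_mul, integral_const_mul, h1]
    ring
  have c2 : cov[R, Z₂; μ] = 0 := by
    rw [covariance_eq_sub mR mZ₂, eZ₂, mul_zero, sub_zero]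
    have : R * Z₂ = fun ω => Y ω * Z₂ ω - α * (Z₁ ω * Z₂ ω) - β * Z₂ ω ^ 2 := by
      ext ω; simp only [hR, Pi.mul_apply]; ring
    have i6 : Integrable (fun ω => Y ω * Z₂ ω - α * (Z₁ ω * Z₂ ω)) μ := i2.sub (i3.const_mul α)
    rw [this, integral_sub i6 (i5.const_mul β),
      integral_sub i2 (i3.const_mul α), integral_const_mul, integral_const_mul, h2]
    ring
  have hG : HasGaussianLaw (fun ω => (R ω, (Z₁ ω, Z₂ ω))) μ := by
    constructor
    apply isGaussian_of_map_eq_gaussianReal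
    intro L
    obtain ⟨v, hv⟩ := hGauss (L (1, 0, 0)) (L (0, 1, 0) - α * L (1, 0, 0))
      (L (0, 0, 1) - β * L (1, 0, 0))
    refine ⟨0, v, ?_⟩
    rw [← hv, Measure.map_map (by fun_prop) (by fun_prop)]
    congr 1
    ext ω
    have : (R ω, (Z₁ ω, Z₂ ω)) = R ω • ((1 : ℝ), ((0 : ℝ), (0 : ℝ)))
        + Z₁ ω • ((0 : ℝ), ((1 : ℝ), (0 : ℝ))) + Z₂ ω • ((0 : ℝ), ((0 : ℝ), (1 : ℝ))) := by
      simp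
    simp only [Function.comp_apply]
    rw [this, map_add, map_add, map_smul, map_smul, map_smul]
    simp only [hR, smul_eq_mul]
    ring
  have hind : IndepFun R (fun ω => (Z₁ ω, Z₂ ω)) μ := by
    apply hG.indepFun_of_covariance_strongDual
    intro L₁ L₂
    have e1 : L₁ ∘ R = fun ω => L₁ 1 * R ω := by
      ext ω
      have : R ω = R ω • (1 : ℝ) := by simp
      rw [Function.comp_apply, this, map_smul]
      simp [mul_comm]
    have e2 : (L₂ ∘ fun ω => (Z₁ ω, Z₂ ω))
        = (fun ω => L₂ (1, 0) * Z₁ ω) + (fun ω => L₂ (0, 1) * Z₂ ω) := by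
      ext ω
      have : (Z₁ ω, Z₂ ω) = Z₁ ω • ((1 : ℝ), (0 : ℝ)) + Z₂ ω • ((0 : ℝ), (1 : ℝ)) := by simp
      rw [Function.comp_apply, this, map_add, map_smul, map_smul]
      simp [mul_comm]
    rw [e1, e2, covariance_const_mul_left,
      covariance_add_right mR (mZ₁.const_mul _) (mZ₂.const_mul _),
      covariance_const_mul_right, covariance_const_mul_right, c1, c2]
    simp
  have hZm : Measurable (fun ω => (Z₁ ω, Z₂ ω)) := by fun_prop
  set m : MeasurableSpace Ω := MeasurableSpace.comap (fun ω => (Z₁ ω, Z₂ ω)) inferInstance with hm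
  have hle := hZm.comap_le
  have hcR : μ[R | m] =ᵐ[μ] fun _ => μ[R] :=
    condExp_indep_eq hRm.comap_le hle (comap_measurable R).stronglyMeasurable hind
  have hS : StronglyMeasurable[m] (fun ω => α * Z₁ ω + β * Z₂ ω) := by
    have hf : Measurable (fun p : ℝ × ℝ => α * p.1 + β * p.2) := by fun_prop
    exact (hf.comp (comap_measurable (fun ω => (Z₁ ω, Z₂ ω)))).stronglyMeasurable
  have iS : Integrable (fun ω => α * Z₁ ω + β * Z₂ ω) μ :=
    ((mZ₁.const_mul α).add (mZ₂.const_mul β)).integrable (by norm_num)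
  have hdec : Y = R + fun ω => α * Z₁ ω + β * Z₂ ω := by
    ext ω; simp only [hR, Pi.add_apply]; ring
  have hadd := condExp_add (mR.integrable (by norm_num)) iS m
  rw [← hdec, condExp_of_stronglyMeasurable hle hS iS] at hadd
  filter_upwards [hadd, hcR] with ω h1 h2
  rw [h1, Pi.add_apply, h2, eR, zero_add]

/-- Optimal one-observation forecast for a bivariate time-reversible fBm:
the conditional expectation of `Y = B^{(1)}_{t+h}` given `Z = (B^{(1)}_t, B^{(2)}_t)`
is the stated linear combination. -/
theorem bivariate_fbm_one_step_forecast
    {Ω : Type*} [MeasurableSpace Ω] (μ : Measure Ω) [IsProbabilityMeasure μ]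
    (Y Z₁ Z₂ : Ω → ℝ) (hY : Measurable Y) (hZ₁ : Measurable Z₁) (hZ₂ : Measurable Z₂)
    (hGauss : ∀ a b c : ℝ, ∃ v : NNReal,
      Measure.map (fun ω => a * Y ω + b * Z₁ ω + c * Z₂ ω) μ = gaussianReal 0 v)
    (H₁ H₂ σ₁ σ₂ ρ t h : ℝ)
    (hH₁ : H₁ ∈ Set.Ioo (0 : ℝ) 1) (hH₂ : H₂ ∈ Set.Ioo (0 : ℝ) 1)
    (hσ₁ : 0 < σ₁) (hσ₂ : 0 < σ₂) (hρ : |ρ| < 1) (ht : 0 < t) (hh : 0 < h)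
    -- `w(t,h,H) = (1/2)((t+h)^{2H} + t^{2H} - h^{2H})`, `H = (H₁+H₂)/2`
    (w : ℝ → ℝ → ℝ → ℝ)
    (hw : ∀ t' h' H', w t' h' H' = (1 / 2) * ((t' + h') ^ (2 * H') + t' ^ (2 * H') - h' ^ (2 * H')))
    (hVarY : ∫ ω, (Y ω) ^ 2 ∂μ = σ₁ ^ 2 * (t + h) ^ (2 * H₁))
    (hYZ₁ : ∫ ω, Y ω * Z₁ ω ∂μ = σ₁ ^ 2 * w t h H₁)
    (hYZ₂ : ∫ ω, Y ω * Z₂ ω ∂μ = ρ * σ₁ * σ₂ * w t h ((H₁ + H₂) / 2))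
    (hVarZ₁ : ∫ ω, (Z₁ ω) ^ 2 ∂μ = σ₁ ^ 2 * t ^ (2 * H₁))
    (hZ₁Z₂ : ∫ ω, Z₁ ω * Z₂ ω ∂μ = ρ * σ₁ * σ₂ * t ^ (2 * ((H₁ + H₂) / 2)))
    (hVarZ₂ : ∫ ω, (Z₂ ω) ^ 2 ∂μ = σ₂ ^ 2 * t ^ (2 * H₂)) :
    μ[Y | MeasurableSpace.comap (fun ω => (Z₁ ω, Z₂ ω)) inferInstance]
      =ᵐ[μ] fun ω =>
        ((1 / (1 - ρ ^ 2)) * (w t h H₁ / t ^ (2 * H₁)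
            - ρ ^ 2 * (w t h ((H₁ + H₂) / 2) / t ^ (2 * ((H₁ + H₂) / 2))))) * Z₁ ω
        + ((ρ / (1 - ρ ^ 2)) * (σ₁ / σ₂) * (w t h ((H₁ + H₂) / 2) / t ^ (2 * H₂)
            - w t h H₁ / t ^ (2 * ((H₁ + H₂) / 2)))) * Z₂ ω := by
  have hp : t ^ (2 * ((H₁ + H₂) / 2)) = t ^ H₁ * t ^ H₂ := by
    rw [← Real.rpow_add ht]; ring_nf
  have hp1 : t ^ (2 * H₁) = (t ^ H₁) ^ 2 := by
    rw [mul_comm, Real.rpow_mul ht.le]; norm_cast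
  have hp2 : t ^ (2 * H₂) = (t ^ H₂) ^ 2 := by
    rw [mul_comm, Real.rpow_mul ht.le]; norm_cast
  have ha : t ^ H₁ ≠ 0 := (Real.rpow_pos_of_pos ht _).ne'
  have hb : t ^ H₂ ≠ 0 := (Real.rpow_pos_of_pos ht _).ne'
  have hr : 1 - ρ ^ 2 ≠ 0 := by
    have := (sq_lt_one_iff_abs_lt_one ρ).2 hρ
    linarith
  have hs1 := hσ₁.ne'
  have hs2 := hσ₂.ne'
  apply condExp_of_normal_equations μ Y Z₁ Z₂ hY hZ₁ hZ₂ hGauss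
  · rw [hYZ₁, hVarZ₁, hZ₁Z₂, hp, hp1, hp2]
    generalize w t h H₁ = w1
    generalize w t h ((H₁ + H₂) / 2) = w2
    field_simp
    ring
  · rw [hYZ₂, hVarZ₂, hZ₁Z₂, hp, hp1, hp2]
    generalize w t h H₁ = w1
    generalize w t h ((H₁ + H₂) / 2) = w2
    field_simp
    ring
end

section
/- In the setting of the bivariate single-observation forecast, the mean squared forecast error equals E[(Ŷ - Y)²] = σ₁²(t+h)^{2H₁} - (σ₁²/(1-ρ²)) w(t,h,H₁)²/t^{2H₁} + (σ₁²ρ²/(1-ρ²)) (2 w(t,h,H₁) w(t,h,H)/t^{2H} - w(t,h,H)²/t^{2H₂}), and this equals the conditional variance Σ_Y - Σ_{YZ} Σ_Z^{-1} Σ_{YZ}^⊤. -/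
open MeasureTheory ProbabilityTheory Real Matrix

theorem gauss_key {Ω : Type*} [MeasurableSpace Ω] (μ : Measure Ω) [IsProbabilityMeasure μ]
    (Y Z₁ Z₂ : Ω → ℝ) (hY : Measurable Y) (hZ₁ : Measurable Z₁) (hZ₂ : Measurable Z₂)
    (hGauss : ∀ a b c : ℝ, ∃ v : NNReal,
      Measure.map (fun ω => a * Y ω + b * Z₁ ω + c * Z₂ ω) μ = gaussianReal 0 v)
    (α β : ℝ)
    (h1 : ∫ ω, Y ω * Z₁ ω ∂μ = α * ∫ ω, (Z₁ ω) ^ 2 ∂μ + β * ∫ ω, Z₁ ω * Z₂ ω ∂μ)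
    (h2 : ∫ ω, Y ω * Z₂ ω ∂μ = α * ∫ ω, Z₁ ω * Z₂ ω ∂μ + β * ∫ ω, (Z₂ ω) ^ 2 ∂μ) :
    ∫ ω, ((μ[Y | MeasurableSpace.comap (fun ω' => (Z₁ ω', Z₂ ω')) inferInstance]) ω
          - Y ω) ^ 2 ∂μ
      = ∫ ω, (Y ω) ^ 2 ∂μ - α * ∫ ω, Y ω * Z₁ ω ∂μ - β * ∫ ω, Y ω * Z₂ ω ∂μ := by
  set R : Ω → ℝ := fun ω => Y ω - (α * Z₁ ω + β * Z₂ ω) with hR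
  have hRm : Measurable R := by fun_prop
  have hLp : ∀ a b c : ℝ, MemLp (fun ω => a * Y ω + b * Z₁ ω + c * Z₂ ω) 2 μ := by
    intro a b c
    obtain ⟨v, hv⟩ := hGauss a b c
    have : HasGaussianLaw (fun ω => a * Y ω + b * Z₁ ω + c * Z₂ ω) μ :=
      ⟨by rw [hv]; infer_instance⟩
    exact this.memLp_two
  have hmean : ∀ a b c : ℝ, ∫ ω, (a * Y ω + b * Z₁ ω + c * Z₂ ω) ∂μ = 0 := by
    intro a b c
    obtain ⟨v, hv⟩ := hGauss a b c
    have := integral_map (μ := μ) (φ := fun ω => a * Y ω + b * Z₁ ω + c * Z₂ ω)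
      (f := fun x : ℝ => x) (by fun_prop) (by fun_prop)
    rw [← this, hv]
    simp
  have LY : MemLp Y 2 μ := by simpa using hLp 1 0 0
  have L1 : MemLp Z₁ 2 μ := by simpa using hLp 0 1 0
  have L2 : MemLp Z₂ 2 μ := by simpa using hLp 0 0 1
  have hReq : R = fun ω => 1 * Y ω + (-α) * Z₁ ω + (-β) * Z₂ ω := by
    ext ω; simp only [hR]; ring
  have LR : MemLp R 2 μ := by rw [hReq]; exact hLp 1 (-α) (-β)
  have mR : ∫ ω, R ω ∂μ = 0 := by rw [hReq]; exact hmean 1 (-α) (-β)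
  have iYY : Integrable (fun ω => Y ω ^ 2) μ := LY.integrable_sq
  have i11 : Integrable (fun ω => Z₁ ω ^ 2) μ := L1.integrable_sq
  have i22 : Integrable (fun ω => Z₂ ω ^ 2) μ := L2.integrable_sq
  have iY1 : Integrable (fun ω => Y ω * Z₁ ω) μ := LY.integrable_mul L1
  have iY2 : Integrable (fun ω => Y ω * Z₂ ω) μ := LY.integrable_mul L2
  have i12 : Integrable (fun ω => Z₁ ω * Z₂ ω) μ := L1.integrable_mul L2
  have iR1 : Integrable (fun ω => R ω * Z₁ ω) μ := LR.integrable_mul L1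
  have iR2 : Integrable (fun ω => R ω * Z₂ ω) μ := LR.integrable_mul L2
  have iRY : Integrable (fun ω => R ω * Y ω) μ := LR.integrable_mul LY
  have o1 : ∫ ω, R ω * Z₁ ω ∂μ = 0 := by
    have : (fun ω => R ω * Z₁ ω) =
        fun ω => Y ω * Z₁ ω - (α * Z₁ ω ^ 2 + β * (Z₁ ω * Z₂ ω)) := by
      ext ω; simp only [hR]; ring
    rw [this, integral_sub iY1 (by exact (i11.const_mul α).add (i12.const_mul β)),
      integral_add (i11.const_mul α) (i12.const_mul β), integral_const_mul, integral_const_mul, h1]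
    ring
  have o2 : ∫ ω, R ω * Z₂ ω ∂μ = 0 := by
    have : (fun ω => R ω * Z₂ ω) =
        fun ω => Y ω * Z₂ ω - (α * (Z₁ ω * Z₂ ω) + β * Z₂ ω ^ 2) := by
      ext ω; simp only [hR]; ring
    rw [this, integral_sub iY2 (by exact (i12.const_mul α).add (i22.const_mul β)),
      integral_add (i12.const_mul α) (i22.const_mul β), integral_const_mul, integral_const_mul, h2]
    ring
  have oY : ∫ ω, R ω * Y ω ∂μ
      = ∫ ω, (Y ω) ^ 2 ∂μ - α * ∫ ω, Y ω * Z₁ ω ∂μ - β * ∫ ω, Y ω * Z₂ ω ∂μ := by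
    have : (fun ω => R ω * Y ω) =
        fun ω => Y ω ^ 2 - (α * (Y ω * Z₁ ω) + β * (Y ω * Z₂ ω)) := by
      ext ω; simp only [hR]; ring
    rw [this, integral_sub iYY (by exact (iY1.const_mul α).add (iY2.const_mul β)),
      integral_add (iY1.const_mul α) (iY2.const_mul β), integral_const_mul, integral_const_mul]
    ring
  have oR : ∫ ω, (R ω) ^ 2 ∂μ = ∫ ω, R ω * Y ω ∂μ := by
    have : (fun ω => R ω ^ 2) =
        fun ω => R ω * Y ω - (α * (R ω * Z₁ ω) + β * (R ω * Z₂ ω)) := by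
      ext ω; simp only [hR]; ring
    rw [this, integral_sub iRY (by exact (iR1.const_mul α).add (iR2.const_mul β)),
      integral_add (iR1.const_mul α) (iR2.const_mul β), integral_const_mul, integral_const_mul,
      o1, o2]
    ring
  -- joint Gaussianity of the residual and the observations
  have hJ : HasGaussianLaw (fun ω => (R ω, (Z₁ ω, Z₂ ω))) μ := by
    refine ⟨isGaussian_of_map_eq_gaussianReal fun L => ?_⟩
    obtain ⟨v, hv⟩ := hGauss (L (1, (0, 0))) (L (0, (1, 0)) - α * L (1, (0, 0)))
      (L (0, (0, 1)) - β * L (1, (0, 0)))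
    refine ⟨0, v, ?_⟩
    rw [Measure.map_map (by fun_prop) (by fun_prop), ← hv]
    congr 1
    ext ω
    have : (R ω, (Z₁ ω, Z₂ ω)) = R ω • ((1, (0, 0)) : ℝ × ℝ × ℝ)
        + (Z₁ ω • ((0, (1, 0)) : ℝ × ℝ × ℝ) + Z₂ ω • ((0, (0, 1)) : ℝ × ℝ × ℝ)) := by
      simp
    simp only [Function.comp_apply]
    rw [this, map_add, map_add, map_smul, map_smul, map_smul]
    simp only [smul_eq_mul, hR]
    ring
  have hInd : IndepFun R (fun ω => (Z₁ ω, Z₂ ω)) μ := by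
    refine hJ.indepFun_of_covariance_strongDual fun M N => ?_
    have e1 : (M ∘ R) = fun ω => M 1 * R ω := by
      ext ω
      have : R ω = R ω • (1 : ℝ) := by simp
      simp only [Function.comp_apply]
      rw [this, map_smul]; simp [mul_comm]
    have e2 : (N ∘ fun ω => (Z₁ ω, Z₂ ω)) = fun ω => N (1, 0) * Z₁ ω + N (0, 1) * Z₂ ω := by
      ext ω
      have : (Z₁ ω, Z₂ ω) = Z₁ ω • ((1, 0) : ℝ × ℝ) + Z₂ ω • ((0, 1) : ℝ × ℝ) := by simp
      simp only [Function.comp_apply]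
      rw [this, map_add, map_smul, map_smul]
      simp only [smul_eq_mul]; ring
    rw [e1, e2, covariance_eq_sub (by exact LR.const_mul _) (by exact (L1.const_mul _).add (L2.const_mul _)),
      integral_const_mul, mR]
    have : ((fun ω => M 1 * R ω) * fun ω => N (1, 0) * Z₁ ω + N (0, 1) * Z₂ ω)
        = fun ω => (M 1 * N (1, 0)) * (R ω * Z₁ ω) + (M 1 * N (0, 1)) * (R ω * Z₂ ω) := by
      ext ω; simp only [Pi.mul_apply]; ring
    rw [this, integral_add (iR1.const_mul _) (iR2.const_mul _), integral_const_mul,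
      integral_const_mul, o1, o2]
    simp
  have hZm : Measurable (fun ω => (Z₁ ω, Z₂ ω)) := by fun_prop
  set m := MeasurableSpace.comap (fun ω' => (Z₁ ω', Z₂ ω')) inferInstance with hm
  have hle : m ≤ _ := hZm.comap_le
  have hcR : μ[R | m] =ᵐ[μ] fun _ => μ[R] :=
    condExp_indep_eq hRm.comap_le hle (comap_measurable R).stronglyMeasurable hInd
  have hSm : StronglyMeasurable[m] (fun ω => α * Z₁ ω + β * Z₂ ω) := by
    have hg : Measurable (fun p : ℝ × ℝ => α * p.1 + β * p.2) := by fun_prop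
    exact (hg.comp (comap_measurable (fun ω' => (Z₁ ω', Z₂ ω')))).stronglyMeasurable
  have iS : Integrable (fun ω => α * Z₁ ω + β * Z₂ ω) μ :=
    ((L1.const_mul α).add (L2.const_mul β)).integrable (by norm_num)
  have hcS := condExp_of_stronglyMeasurable hle hSm iS
  have hYs : Y = R + fun ω => α * Z₁ ω + β * Z₂ ω := by
    ext ω; simp [hR]
  have hcY : μ[Y | m] =ᵐ[μ] μ[R | m] + μ[fun ω => α * Z₁ ω + β * Z₂ ω | m] := by
    conv_lhs => rw [hYs]
    exact condExp_add (LR.integrable (by norm_num)) iS m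
  have hfin : (fun ω => ((μ[Y | m]) ω - Y ω) ^ 2) =ᵐ[μ] fun ω => (R ω) ^ 2 := by
    filter_upwards [hcY, hcR] with ω ha hb
    rw [ha, Pi.add_apply, hb, hcS, mR]
    simp only [hR]; ring
  rw [integral_congr_ae hfin, oR, oY]

/-- The mean squared forecast error of the one-observation bivariate forecast equals the
stated explicit expression, which in turn equals the conditional variance
`Σ_Y - Σ_{YZ} Σ_Z⁻¹ Σ_{YZ}ᵀ`. -/
theorem bivariate_fbm_one_step_msfe
    {Ω : Type*} [MeasurableSpace Ω] (μ : Measure Ω) [IsProbabilityMeasure μ]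
    (Y Z₁ Z₂ : Ω → ℝ) (hY : Measurable Y) (hZ₁ : Measurable Z₁) (hZ₂ : Measurable Z₂)
    (hGauss : ∀ a b c : ℝ, ∃ v : NNReal,
      Measure.map (fun ω => a * Y ω + b * Z₁ ω + c * Z₂ ω) μ = gaussianReal 0 v)
    (H₁ H₂ σ₁ σ₂ ρ t h : ℝ)
    (hH₁ : H₁ ∈ Set.Ioo (0 : ℝ) 1) (hH₂ : H₂ ∈ Set.Ioo (0 : ℝ) 1)
    (hσ₁ : 0 < σ₁) (hσ₂ : 0 < σ₂) (hρ : |ρ| < 1) (ht : 0 < t) (hh : 0 < h)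
    (w : ℝ → ℝ → ℝ → ℝ)
    (hw : ∀ t' h' H', w t' h' H' = (1 / 2) * ((t' + h') ^ (2 * H') + t' ^ (2 * H') - h' ^ (2 * H')))
    (hVarY : ∫ ω, (Y ω) ^ 2 ∂μ = σ₁ ^ 2 * (t + h) ^ (2 * H₁))
    (hYZ₁ : ∫ ω, Y ω * Z₁ ω ∂μ = σ₁ ^ 2 * w t h H₁)
    (hYZ₂ : ∫ ω, Y ω * Z₂ ω ∂μ = ρ * σ₁ * σ₂ * w t h ((H₁ + H₂) / 2))
    (hVarZ₁ : ∫ ω, (Z₁ ω) ^ 2 ∂μ = σ₁ ^ 2 * t ^ (2 * H₁))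
    (hZ₁Z₂ : ∫ ω, Z₁ ω * Z₂ ω ∂μ = ρ * σ₁ * σ₂ * t ^ (2 * ((H₁ + H₂) / 2)))
    (hVarZ₂ : ∫ ω, (Z₂ ω) ^ 2 ∂μ = σ₂ ^ 2 * t ^ (2 * H₂)) :
    (∫ ω, ((μ[Y | MeasurableSpace.comap (fun ω' => (Z₁ ω', Z₂ ω')) inferInstance]) ω
          - Y ω) ^ 2 ∂μ
        = σ₁ ^ 2 * (t + h) ^ (2 * H₁)
          - (σ₁ ^ 2 / (1 - ρ ^ 2)) * (w t h H₁) ^ 2 / t ^ (2 * H₁)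
          + (σ₁ ^ 2 * ρ ^ 2 / (1 - ρ ^ 2)) *
              (2 * w t h H₁ * w t h ((H₁ + H₂) / 2) / t ^ (2 * ((H₁ + H₂) / 2))
                - (w t h ((H₁ + H₂) / 2)) ^ 2 / t ^ (2 * H₂))) ∧
    (σ₁ ^ 2 * (t + h) ^ (2 * H₁)
          - (σ₁ ^ 2 / (1 - ρ ^ 2)) * (w t h H₁) ^ 2 / t ^ (2 * H₁)
          + (σ₁ ^ 2 * ρ ^ 2 / (1 - ρ ^ 2)) *
              (2 * w t h H₁ * w t h ((H₁ + H₂) / 2) / t ^ (2 * ((H₁ + H₂) / 2))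
                - (w t h ((H₁ + H₂) / 2)) ^ 2 / t ^ (2 * H₂))
        = σ₁ ^ 2 * (t + h) ^ (2 * H₁)
          - (![σ₁ ^ 2 * w t h H₁, ρ * σ₁ * σ₂ * w t h ((H₁ + H₂) / 2)] ⬝ᵥ
              ((!![σ₁ ^ 2 * t ^ (2 * H₁), ρ * σ₁ * σ₂ * t ^ (2 * ((H₁ + H₂) / 2));
                  ρ * σ₁ * σ₂ * t ^ (2 * ((H₁ + H₂) / 2)), σ₂ ^ 2 * t ^ (2 * H₂)])⁻¹).mulVec
                ![σ₁ ^ 2 * w t h H₁, ρ * σ₁ * σ₂ * w t h ((H₁ + H₂) / 2)])) := by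
  have hρ2 : 0 < 1 - ρ ^ 2 := by
    have := (sq_lt_one_iff_abs_lt_one ρ).2 hρ
    linarith
  have hT : t ^ (2 * ((H₁ + H₂) / 2)) = t ^ H₁ * t ^ H₂ := by
    rw [← Real.rpow_add ht]; congr 1; ring
  have hT1 : t ^ (2 * H₁) = (t ^ H₁) ^ 2 := by
    rw [mul_comm, Real.rpow_mul ht.le]; norm_cast
  have hT2 : t ^ (2 * H₂) = (t ^ H₂) ^ 2 := by
    rw [mul_comm, Real.rpow_mul ht.le]; norm_cast
  have hp : 0 < t ^ H₁ := Real.rpow_pos_of_pos ht _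
  have hq : 0 < t ^ H₂ := Real.rpow_pos_of_pos ht _
  rw [hT1] at hVarZ₁
  rw [hT2] at hVarZ₂
  rw [hT] at hZ₁Z₂
  rw [hT, hT1, hT2]
  generalize w t h H₁ = u at *
  generalize w t h ((H₁ + H₂) / 2) = x at *
  generalize t ^ H₁ = p at *
  generalize t ^ H₂ = q at *
  have hρ' := hρ2.ne'
  constructor
  · rw [gauss_key μ Y Z₁ Z₂ hY hZ₁ hZ₂ hGauss
      ((u / p ^ 2 - ρ ^ 2 * x / (p * q)) / (1 - ρ ^ 2))
      (ρ * σ₁ / σ₂ * (x / q ^ 2 - u / (p * q)) / (1 - ρ ^ 2)) ?_ ?_, hVarY, hYZ₁, hYZ₂]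
    · field_simp
      ring
    · rw [hYZ₁, hVarZ₁, hZ₁Z₂]
      field_simp
      ring
    · rw [hYZ₂, hVarZ₂, hZ₁Z₂]
      field_simp
      ring
  · have hdet : σ₁ ^ 2 * p ^ 2 * (σ₂ ^ 2 * q ^ 2)
        - ρ * σ₁ * σ₂ * (p * q) * (ρ * σ₁ * σ₂ * (p * q))
        = σ₁ ^ 2 * σ₂ ^ 2 * p ^ 2 * q ^ 2 * (1 - ρ ^ 2) := by ring
    rw [Matrix.inv_def, Matrix.det_fin_two_of, hdet, Matrix.adjugate_fin_two_of,
      Ring.inverse_eq_inv']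
    simp [Matrix.mulVec, dotProduct, Fin.sum_univ_two]
    field_simp
    ring
end
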